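/- Let (u, H̄) be a viscosity solution of the weak KAM equation H(x, −∇u) = H̄ on 𝕋^d and for each N let (φ_N, H̄_N) solve the lattice weak KAM equation 𝓗_N(x, (−Δ_N)φ_N) = H̄_N on Λ_N. Then there is a constant C₂ depending only on L such that |H̄ − H̄_N| ≤ C₂ N^{−1/2}. -/

import Mathlib

open scoped BigOperators RealInnerProductSpace
open MeasureTheory Filter

noncomputable section

abbrev Evec (d : ℕ) := EuclideanSpace ℝ (Fin d)

def sgnz (a : ℝ) : ℤ := if 0 < a then 1 else if a < 0 then -1 else 0

def latE (d N : ℕ) (x : Fin d → ZMod N) : Evec d :=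
  (WithLp.equiv 2 (Fin d → ℝ)).symm fun i => ((x i).val : ℝ) / N

def dplus {d N : ℕ} (φ : (Fin d → ZMod N) → ℝ) (x : Fin d → ZMod N) (i : Fin d) : ℝ :=
  (N : ℝ) * (φ (x + Pi.single i 1) - φ x)

def dminus {d N : ℕ} (φ : (Fin d → ZMod N) → ℝ) (x : Fin d → ZMod N) (i : Fin d) : ℝ :=
  (N : ℝ) * (φ (x - Pi.single i 1) - φ x)

def DeltaN {d N : ℕ} (φ : (Fin d → ZMod N) → ℝ) (x : Fin d → ZMod N) : Fin d → ℝ × ℝ :=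
  fun i => (dplus φ x i, dminus φ x i)

def negDeltaN {d N : ℕ} (φ : (Fin d → ZMod N) → ℝ) (x : Fin d → ZMod N) : Fin d → ℝ × ℝ :=
  fun i => (-dplus φ x i, -dminus φ x i)

def pairL {d : ℕ} (ξ : Fin d → ℝ × ℝ) (v : Evec d) : ℝ :=
  ∑ i, ((ξ i).1 * max (v i) 0 + (ξ i).2 * max (-(v i)) 0)

def QN {d N : ℕ} (v : Evec d) (x y : Fin d → ZMod N) : ℝ :=
  (∑ i, if y = x + Pi.single i ((sgnz (v i) : ZMod N)) then (N : ℝ) * |v i| else 0)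
    - (if y = x then (N : ℝ) * ∑ i, |v i| else 0)

def HNlat {d N : ℕ} (L : Evec d → Evec d → ℝ) (x : Fin d → ZMod N)
    (ξ : Fin d → ℝ × ℝ) : ℝ :=
  ⨆ v : Evec d, (pairL ξ v - L (latE d N x) v)

def Ham (d : ℕ) (L : Evec d → Evec d → ℝ) (x p : Evec d) : ℝ :=
  ⨆ v : Evec d, (⟪p, v⟫ - L x v)

/-- Integer translations along one axis. -/
lemma per_int {d : ℕ} {f : Evec d → ℝ}
    (hf : ∀ (x : Evec d) (i : Fin d), f (x + EuclideanSpace.single i 1) = f x)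
    (x : Evec d) (i : Fin d) (m : ℤ) :
    f (x + (m : ℝ) • EuclideanSpace.single i (1 : ℝ)) = f x := by
  induction m using Int.induction_on with
  | zero => simp
  | succ k ih =>
    rw [← ih, ← hf (x + ((k : ℤ) : ℝ) • EuclideanSpace.single i (1 : ℝ)) i]
    congr 1
    push_cast
    module
  | pred k ih =>
    rw [← ih, ← hf (x + ((-(k : ℤ) - 1 : ℤ) : ℝ) • EuclideanSpace.single i (1 : ℝ)) i]
    congr 1
    push_cast
    module

lemma per_sum {d : ℕ} {f : Evec d → ℝ}
    (hf : ∀ (x : Evec d) (i : Fin d), f (x + EuclideanSpace.single i 1) = f x)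
    (m : Fin d → ℤ) (s : Finset (Fin d)) (x : Evec d) :
    f (x + ∑ i ∈ s, (m i : ℝ) • EuclideanSpace.single i (1 : ℝ)) = f x := by
  classical
  induction s using Finset.induction_on generalizing x with
  | empty => simp
  | insert a s ha ih =>
    rw [Finset.sum_insert ha, ← add_assoc, ih, per_int hf]

/-- Every point has a representative of norm at most `d`. -/
lemma per_rep {d : ℕ} (x : Evec d) : ∃ y : Evec d, ‖y‖ ≤ d ∧
    ∀ f : Evec d → ℝ,
      (∀ (x : Evec d) (i : Fin d), f (x + EuclideanSpace.single i 1) = f x) → f y = f x := by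
  classical
  let m : Fin d → ℤ := fun i => -⌊x i⌋
  refine ⟨x + ∑ i, (m i : ℝ) • EuclideanSpace.single i (1 : ℝ), ?_,
    fun f hf => per_sum hf m Finset.univ x⟩
  set y : Evec d := x + ∑ i, (m i : ℝ) • EuclideanSpace.single i (1 : ℝ) with hy
  have hyi : ∀ j, y j = Int.fract (x j) := by
    intro j
    simp only [hy, PiLp.add_apply, WithLp.ofLp_sum, Finset.sum_apply, PiLp.smul_apply,
      EuclideanSpace.single, PiLp.single_apply, smul_eq_mul, mul_ite, mul_one, mul_zero]
    simp [m, Int.fract, sub_eq_add_neg]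
  have h1 : ‖y‖ ^ 2 ≤ (d : ℝ) ^ 2 := by
    rw [EuclideanSpace.norm_sq_eq]
    calc ∑ i, ‖y i‖ ^ 2 ≤ ∑ i : Fin d, (1 : ℝ) := by
          apply Finset.sum_le_sum
          intro i _
          rw [hyi, Real.norm_eq_abs, sq_abs]
          have := Int.fract_nonneg (x i)
          have := Int.fract_lt_one (x i)
          nlinarith
      _ = (d : ℝ) := by simp
      _ ≤ (d : ℝ) ^ 2 := by
          norm_cast
          exact Nat.le_self_pow (by norm_num) d
  exact (sq_le_sq₀ (norm_nonneg _) (Nat.cast_nonneg _)).1 h1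

lemma L_bdd {d : ℕ} {L : Evec d → Evec d → ℝ}
    (hLc : Continuous (Function.uncurry L))
    (hper : ∀ (x v : Evec d) (i : Fin d), L (x + EuclideanSpace.single i 1) v = L x v) :
    ∃ M : ℝ, 0 ≤ M ∧ ∀ x v : Evec d, ‖v‖ ≤ 1 → L x v ≤ M := by
  have hc : IsCompact (Metric.closedBall (0 : Evec d) d ×ˢ Metric.closedBall (0 : Evec d) 1) :=
    (isCompact_closedBall _ _).prod (isCompact_closedBall _ _)
  obtain ⟨M, hM⟩ := hc.bddAbove_image hLc.continuousOn
  refine ⟨max M 0, le_max_right _ _, fun x v hv => ?_⟩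
  obtain ⟨y, hy, hyf⟩ := per_rep x
  rw [← hyf (fun x => L x v) (fun x i => hper x v i)]
  refine le_trans (hM ⟨(y, v), ?_, rfl⟩) (le_max_left _ _)
  simp [hy, hv]

lemma u_bdd {d : ℕ} {u : Evec d → ℝ} (hc : Continuous u)
    (hper : ∀ (x : Evec d) (i : Fin d), u (x + EuclideanSpace.single i 1) = u x) :
    ∃ B : ℝ, 0 ≤ B ∧ ∀ x, |u x| ≤ B := by
  obtain ⟨M, hM⟩ := (isCompact_closedBall (0 : Evec d) d).bddAbove_image hc.abs.continuousOn
  refine ⟨max M 0, le_max_right _ _, fun x => ?_⟩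
  obtain ⟨y, hy, hyf⟩ := per_rep x
  rw [← hyf u hper]
  exact le_trans (hM ⟨y, by simpa using hy, rfl⟩) (le_max_left _ _)

lemma exists_max_pen {d : ℕ} {w : Evec d → ℝ} (hc : Continuous w) {B : ℝ}
    (hB0 : 0 ≤ B) (hB : ∀ x, |w x| ≤ B) (a : Evec d) {k : ℝ} (hk : 0 < k) :
    ∃ x0, ∀ x, w x - k * ‖x - a‖ ^ 2 ≤ w x0 - k * ‖x0 - a‖ ^ 2 := by
  set r := Real.sqrt (2 * B / k) with hr
  have hr2 : k * r ^ 2 = 2 * B := by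
    rw [hr, Real.sq_sqrt (by positivity)]
    field_simp
  have hcont : Continuous (fun x => w x - k * ‖x - a‖ ^ 2) := by fun_prop
  have hr0 : 0 ≤ r := Real.sqrt_nonneg _
  obtain ⟨x0, -, hx0⟩ := (isCompact_closedBall a r).exists_isMaxOn
    ⟨a, Metric.mem_closedBall_self hr0⟩ hcont.continuousOn
  refine ⟨x0, fun x => ?_⟩
  by_cases hx : x ∈ Metric.closedBall a r
  · exact hx0 hx
  · have h1 : w a - k * ‖a - a‖ ^ 2 ≤ _ := hx0 (Metric.mem_closedBall_self hr0)
    rw [Metric.mem_closedBall, dist_eq_norm, not_le] at hx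
    have h2 : r ^ 2 ≤ ‖x - a‖ ^ 2 := by gcongr
    have h3 := mul_le_mul_of_nonneg_left h2 hk.le
    have h4 := abs_le.1 (hB a)
    have h5 := abs_le.1 (hB x)
    simp at h1
    linarith

lemma latE_succ {d n : ℕ} [NeZero n] (y : Fin d → ZMod n) (i : Fin d) :
    ∃ m : ℤ, latE d n (y + Pi.single i 1) =
      latE d n y + (1 / (n : ℝ) + m) • EuclideanSpace.single i (1 : ℝ) := by
  have hn : (n : ℝ) ≠ 0 := Nat.cast_ne_zero.2 (NeZero.ne n)
  refine ⟨-((((y i).val + 1) / n : ℕ) : ℤ), ?_⟩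
  ext j
  by_cases hj : j = i
  · subst hj
    have h1 : (y j + 1).val = ((y j).val + 1) % n := by
      rw [ZMod.val_add, ZMod.val_one_eq_one_mod]; simp
    have h2 := Nat.mod_add_div ((y j).val + 1) n
    have h3 : ((((y j).val + 1) % n : ℕ) : ℝ) + n * (((y j).val + 1) / n : ℕ) = (y j).val + 1 := by
      exact_mod_cast h2
    simp only [latE, WithLp.equiv_symm_apply, PiLp.add_apply, PiLp.smul_apply, Pi.add_apply,
      Pi.single_eq_same, h1, EuclideanSpace.single, PiLp.single_apply, if_true, smul_eq_mul, mul_one]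
    rw [eq_sub_of_add_eq h3, Int.cast_neg, Int.cast_natCast]
    field_simp
    ring
  · simp [latE, hj]

/-- The doubling of variables step. -/
lemma doubling {d n : ℕ} [NeZero n] {w : Evec d → ℝ} (hc : Continuous w)
    (hper : ∀ (x : Evec d) (i : Fin d), w (x + EuclideanSpace.single i 1) = w x)
    (θ : (Fin d → ZMod n) → ℝ) {k : ℝ} (hk : 0 < k) :
    ∃ (x0 : Evec d) (y0 : Fin d → ZMod n),
      (∀ x, w x - k * ‖x - latE d n y0‖ ^ 2 ≤ w x0 - k * ‖x0 - latE d n y0‖ ^ 2) ∧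
      (∀ i, dplus θ y0 i ≤ k / n - 2 * k * (x0 - latE d n y0) i) ∧
      (∀ i, dminus θ y0 i ≤ k / n + 2 * k * (x0 - latE d n y0) i) := by
  obtain ⟨B, hB0, hB⟩ := u_bdd hc hper
  have hn : (0 : ℝ) < n := Nat.cast_pos.2 (NeZero.pos n)
  choose X hX using fun y : Fin d → ZMod n => exists_max_pen hc hB0 hB (latE d n y) hk
  obtain ⟨y0, hy0⟩ := Finite.exists_max
    (fun y => w (X y) - k * ‖X y - latE d n y‖ ^ 2 + θ y)
  have key : ∀ x y, w x - k * ‖x - latE d n y‖ ^ 2 + θ y ≤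
      w (X y0) - k * ‖X y0 - latE d n y0‖ ^ 2 + θ y0 := fun x y =>
    le_trans (by have := hX y x; linarith) (hy0 y)
  have step : ∀ (i : Fin d) (y : Fin d → ZMod n) (s : ℝ) (m : ℤ),
      latE d n y = latE d n y0 + (s + m) • EuclideanSpace.single i (1 : ℝ) →
      θ y - θ y0 ≤ k * (s ^ 2 - 2 * s * (X y0 - latE d n y0) i) := by
    intro i y s m hy
    have h1 := key (X y0 + (m : ℝ) • EuclideanSpace.single i (1 : ℝ)) y
    rw [per_int hper] at h1
    have h2 : X y0 + (m : ℝ) • EuclideanSpace.single i (1 : ℝ) - latE d n y =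
        (X y0 - latE d n y0) - s • EuclideanSpace.single i (1 : ℝ) := by
      rw [hy]; module
    have h3 : ‖(X y0 - latE d n y0) - s • EuclideanSpace.single i (1 : ℝ)‖ ^ 2 =
        ‖X y0 - latE d n y0‖ ^ 2 - 2 * s * (X y0 - latE d n y0) i + s ^ 2 := by
      rw [norm_sub_sq_real, inner_smul_right, EuclideanSpace.inner_single_right, norm_smul]
      simp
      ring
    rw [h2, h3] at h1
    linarith
  refine ⟨X y0, y0, hX y0, fun i => ?_, fun i => ?_⟩
  · obtain ⟨m, hm⟩ := latE_succ y0 i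
    have h := step i _ _ _ hm
    have h' := mul_le_mul_of_nonneg_left h hn.le
    refine h'.trans (le_of_eq ?_)
    field_simp
  · obtain ⟨m, hm⟩ := latE_succ (y0 - Pi.single i 1) i
    rw [sub_add_cancel] at hm
    have h := step i (y0 - Pi.single i 1) (-(1 / (n : ℝ))) (-m) (by
      rw [hm]; push_cast; module)
    have h' := mul_le_mul_of_nonneg_left h hn.le
    refine h'.trans (le_of_eq ?_)
    field_simp
    ring

lemma sum_abs_le {d : ℕ} (v : Evec d) : ∑ i, |v i| ≤ d * ‖v‖ := by
  calc ∑ i, |v i| ≤ ∑ i : Fin d, ‖v‖ :=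
        Finset.sum_le_sum fun i _ => by simpa using PiLp.norm_apply_le v i
    _ = d * ‖v‖ := by simp

lemma inner_eq {d : ℕ} (p v : Evec d) : ⟪p, v⟫ = ∑ i, p i * v i := by
  simp [PiLp.inner_apply, mul_comm]

lemma max_id (a : ℝ) : max a 0 - max (-a) 0 = a := by
  rcases le_total a 0 with h | h
  · rw [max_eq_right h, max_eq_left (by linarith)]; ring
  · rw [max_eq_left h, max_eq_right (by linarith)]; ring

lemma max_abs (a : ℝ) : max a 0 + max (-a) 0 = |a| := by
  rcases le_total a 0 with h | h
  · rw [max_eq_right h, max_eq_left (by linarith), abs_of_nonpos h]; ring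
  · rw [max_eq_left h, max_eq_right (by linarith), abs_of_nonneg h]; ring

lemma pairL_le {d : ℕ} {ξ : Fin d → ℝ × ℝ} {p : Evec d} {e : ℝ} (he : 0 ≤ e)
    (h1 : ∀ i, (ξ i).1 ≤ e + p i) (h2 : ∀ i, (ξ i).2 ≤ e - p i) (v : Evec d) :
    pairL ξ v ≤ ⟪p, v⟫ + e * d * ‖v‖ := by
  have h3 : pairL ξ v ≤ ∑ i, (p i * v i + e * |v i|) := by
    apply Finset.sum_le_sum
    intro i _
    have a1 := mul_le_mul_of_nonneg_right (h1 i) (le_max_right (v i) 0)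
    have a2 := mul_le_mul_of_nonneg_right (h2 i) (le_max_right (-(v i)) 0)
    have a3 : p i * v i = p i * (max (v i) 0 - max (-(v i)) 0) := by rw [max_id]
    rw [a3, ← max_abs]
    linarith
  rw [Finset.sum_add_distrib, ← inner_eq, ← Finset.mul_sum] at h3
  have := mul_le_mul_of_nonneg_left (sum_abs_le v) he
  linarith

lemma le_pairL {d : ℕ} {ξ : Fin d → ℝ × ℝ} {p : Evec d} {e : ℝ} (he : 0 ≤ e)
    (h1 : ∀ i, p i - e ≤ (ξ i).1) (h2 : ∀ i, -p i - e ≤ (ξ i).2) (v : Evec d) :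
    ⟪p, v⟫ - e * d * ‖v‖ ≤ pairL ξ v := by
  have h3 : ∑ i, (p i * v i - e * |v i|) ≤ pairL ξ v := by
    apply Finset.sum_le_sum
    intro i _
    have a1 := mul_le_mul_of_nonneg_right (h1 i) (le_max_right (v i) 0)
    have a2 := mul_le_mul_of_nonneg_right (h2 i) (le_max_right (-(v i)) 0)
    have a3 : p i * v i = p i * (max (v i) 0 - max (-(v i)) 0) := by rw [max_id]
    rw [a3, ← max_abs]
    linarith
  rw [Finset.sum_sub_distrib, ← inner_eq, ← Finset.mul_sum] at h3
  have := mul_le_mul_of_nonneg_left (sum_abs_le v) he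
  linarith

lemma Ham_bdd {d : ℕ} {L : Evec d → Evec d → ℝ} {g : ℝ → ℝ}
    (hsl : ∀ a : ℝ, 0 ≤ a → ∀ (x v : Evec d), a * ‖v‖ + g a ≤ L x v) (x p : Evec d) :
    BddAbove (Set.range fun v : Evec d => ⟪p, v⟫ - L x v) := by
  refine ⟨-g ‖p‖, ?_⟩
  rintro _ ⟨v, rfl⟩
  have := hsl ‖p‖ (norm_nonneg _) x v
  have := real_inner_le_norm p v
  simp only
  linarith

lemma HN_bdd {d n : ℕ} {L : Evec d → Evec d → ℝ} {g : ℝ → ℝ}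
    (hsl : ∀ a : ℝ, 0 ≤ a → ∀ (x v : Evec d), a * ‖v‖ + g a ≤ L x v)
    (x : Fin d → ZMod n) (ξ : Fin d → ℝ × ℝ) :
    BddAbove (Set.range fun v : Evec d => pairL ξ v - L (latE d n x) v) := by
  set e : ℝ := ∑ i, (|(ξ i).1| + |(ξ i).2|) with he
  have he0 : 0 ≤ e := by positivity
  have hle : ∀ i, |(ξ i).1| + |(ξ i).2| ≤ e := fun i =>
    Finset.single_le_sum (f := fun i => |(ξ i).1| + |(ξ i).2|)
      (fun i _ => by positivity) (Finset.mem_univ i)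
  refine ⟨-g (e * d), ?_⟩
  rintro _ ⟨v, rfl⟩
  have h1 := hsl (e * d) (by positivity) (latE d n x) v
  have h2 := pairL_le (ξ := ξ) (p := 0) he0
    (fun i => by
      have := hle i; have := le_abs_self (ξ i).1; have := abs_nonneg (ξ i).2
      simp; linarith)
    (fun i => by
      have := hle i; have := le_abs_self (ξ i).2; have := abs_nonneg (ξ i).1
      simp; linarith) v
  simp only [inner_zero_left] at h2
  simp only
  linarith

lemma unit_vec {d : ℕ} (p : Evec d) : ∃ v : Evec d, ‖v‖ ≤ 1 ∧ ⟪p, v⟫ = ‖p‖ := by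
  refine ⟨‖p‖⁻¹ • p, ?_, ?_⟩
  · rw [norm_smul, norm_inv, norm_norm]
    exact inv_mul_le_one
  · rw [inner_smul_right, real_inner_self_eq_norm_sq]
    by_cases h : ‖p‖ = 0
    · simp [h]
    · field_simp

lemma hasGrad {d : ℕ} (a x : Evec d) (k : ℝ) :
    gradient (fun y => k * ‖y - a‖ ^ 2) x = (2 * k) • (x - a) := by
  apply HasGradientAt.gradient
  rw [hasGradientAt_iff_hasFDerivAt]
  have h := (((hasFDerivAt_id x).sub_const a).norm_sq).const_mul k
  refine h.congr_fderiv ?_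
  ext v
  simp
  ring

lemma pen_contDiff {d : ℕ} (a : Evec d) (k : ℝ) :
    ContDiff ℝ 1 (fun y : Evec d => k * ‖y - a‖ ^ 2) :=
  contDiff_const.mul ((contDiff_id.sub contDiff_const).norm_sq ℝ)

/-- approximation of the effective Hamiltonian: if `(u, H̄)` is a
viscosity solution of `H(x, −∇u) = H̄` on `𝕋^d` and `(φ_N, H̄_N)` solves the lattice
weak KAM equation, then `|H̄ − H̄_N| ≤ C₂ N^{−1/2}` with `C₂` depending only on `L`. -/
theorem stmt15 (d : ℕ) (L : Evec d → Evec d → ℝ) (g : ℝ → ℝ)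
    (hLc : Continuous (Function.uncurry L))
    (hconv : ∀ x : Evec d, ConvexOn ℝ Set.univ (L x))
    (hsl : ∀ a : ℝ, 0 ≤ a → ∀ (x v : Evec d), a * ‖v‖ + g a ≤ L x v)
    (hper : ∀ (x v : Evec d) (i : Fin d), L (x + EuclideanSpace.single i 1) v = L x v)
    (hLx : ∀ c : ℝ, 0 ≤ c → ∃ K : ℝ, ∀ (x y v : Evec d), ‖v‖ ≤ c →
      |L x v - L y v| ≤ K * ‖x - y‖) :
    ∃ C : ℝ, ∀ (N : ℕ) (u : Evec d → ℝ) (Hbar : ℝ), Continuous u →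
      (∀ (x : Evec d) (i : Fin d), u (x + EuclideanSpace.single i 1) = u x) →
      (∀ (x : Evec d) (ψ : Evec d → ℝ), ContDiff ℝ 1 ψ →
        IsLocalMin (fun y => u y - ψ y) x → Hbar ≤ Ham d L x (-(gradient ψ x))) →
      (∀ (x : Evec d) (ψ : Evec d → ℝ), ContDiff ℝ 1 ψ →
        IsLocalMax (fun y => u y - ψ y) x → Ham d L x (-(gradient ψ x)) ≤ Hbar) →
      ∀ (φN : (Fin d → ZMod (N + 1)) → ℝ) (HbarN : ℝ),
        (∀ x, HNlat L x (negDeltaN φN x) = HbarN) →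
        |Hbar - HbarN| ≤ C * ((N : ℝ) + 1) ^ (-(1 : ℝ) / 2) := by
  obtain ⟨M, hM0, hM⟩ := L_bdd hLc hper
  set R : ℝ := |g 0| + M + d with hR
  have hR0 : 0 ≤ R := by positivity
  set A : ℝ := R + d + 1 with hA
  have hA0 : 0 ≤ A := by positivity
  set c : ℝ := |g A| + M + d with hcdef
  have hc0 : 0 ≤ c := by positivity
  obtain ⟨K, hK⟩ := hLx c hc0
  have hd0 : (0 : ℝ) ≤ d := Nat.cast_nonneg d
  -- large velocities are never competitive
  have hlarge : ∀ x v : Evec d, c < ‖v‖ → (R + d) * ‖v‖ - L x v ≤ -M := by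
    intro x v hv
    have h1 := hsl A hA0 x v
    have h2 := neg_abs_le (g A)
    rw [hA] at h1
    rw [hcdef] at hv
    rw [← hA] at h1
    have h3 : A * ‖v‖ = (R + d) * ‖v‖ + ‖v‖ := by rw [hA]; ring
    linarith
  refine ⟨d * c + |K| * R, ?_⟩
  intro N u Hbar huc hup hsup hsub φ HN hφ
  set s : ℝ := ((N : ℝ) + 1) ^ (-(1 : ℝ) / 2) with hs
  have hn : (0 : ℝ) < (N : ℝ) + 1 := by positivity
  have hs0 : 0 < s := Real.rpow_pos_of_pos hn _
  have hs1 : s ≤ 1 := Real.rpow_le_one_of_one_le_of_nonpos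
    (by have : (0 : ℝ) ≤ N := Nat.cast_nonneg N
        linarith) (by norm_num)
  have hsn : s * s * ((N : ℝ) + 1) = 1 := by
    rw [hs, ← Real.rpow_add hn]
    norm_num
    rw [Real.rpow_neg_one]
    field_simp
  set k : ℝ := 1 / (2 * s) with hk
  have hk0 : 0 < k := by positivity
  have hkn : k / ((N + 1 : ℕ) : ℝ) = s / 2 := by
    rw [hk]
    push_cast
    field_simp
    linarith
  -- general bounds on `HN`
  have hHNlow : -M ≤ HN := by
    rw [← hφ 0]
    refine le_trans ?_ (le_ciSup (HN_bdd hsl _ _) 0)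
    have := hM (latE d (N + 1) 0) 0 (by simp)
    simp [pairL]
    linarith
  have hHNup : HN ≤ |g 0| := by
    obtain ⟨y, hy⟩ := Finite.exists_min φ
    rw [← hφ y]
    apply ciSup_le
    intro v
    have h1 := pairL_le (ξ := negDeltaN φ y) (p := 0) le_rfl
      (fun i => by
        have := hy (y + Pi.single i 1)
        have h2 : 0 ≤ dplus φ y i := mul_nonneg (Nat.cast_nonneg _) (by linarith)
        simpa [negDeltaN] using h2)
      (fun i => by
        have := hy (y - Pi.single i 1)
        have h2 : 0 ≤ dminus φ y i := mul_nonneg (Nat.cast_nonneg _) (by linarith)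
        simpa [negDeltaN] using h2) v
    have h3 := hsl 0 le_rfl (latE d (N + 1) y) v
    have := neg_abs_le (g 0)
    simp at h1
    linarith
  have hLdiff : ∀ (x a v : Evec d), ‖v‖ ≤ c → ‖(2 * k) • (x - a)‖ ≤ R →
      |L x v - L a v| ≤ |K| * R * s := by
    intro x a v hv hp
    have h1 : ‖x - a‖ = s * ‖(2 * k) • (x - a)‖ := by
      rw [norm_smul, Real.norm_of_nonneg (by positivity), hk]
      field_simp
    calc |L x v - L a v| ≤ K * ‖x - a‖ := hK x a v hv
      _ ≤ |K| * ‖x - a‖ := mul_le_mul_of_nonneg_right (le_abs_self K) (norm_nonneg _)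
      _ = |K| * s * ‖(2 * k) • (x - a)‖ := by rw [h1]; ring
      _ ≤ |K| * s * R := mul_le_mul_of_nonneg_left hp (by positivity)
      _ = |K| * R * s := by ring
  have hpen : ∀ v : Evec d, ‖v‖ ≤ c → s / 2 * d * ‖v‖ ≤ d * c * s := by
    intro v hv
    have h1 : s / 2 * d * ‖v‖ ≤ s / 2 * d * c := mul_le_mul_of_nonneg_left hv (by positivity)
    have h2 : 0 ≤ s * d * c := by positivity
    linarith
  have hpen' : ∀ v : Evec d, s / 2 * d * ‖v‖ ≤ d * ‖v‖ := by
    intro v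
    have h2 : 0 ≤ d * ‖v‖ := by positivity
    have h1 := mul_le_mul_of_nonneg_right (show s / 2 ≤ 1 by linarith) h2
    linarith
  have hC0 : 0 ≤ (d * c + |K| * R) * s := by positivity
  rw [abs_le]
  constructor
  · -- HN ≤ Hbar + C s
    rcases le_or_gt HN Hbar with hle | hlt
    · linarith
    obtain ⟨x0, y0, hmax, hp1, hp2⟩ := doubling huc hup (fun y => -φ y) hk0
    set a := latE d (N + 1) y0 with ha
    set p : Evec d := (2 * k) • (x0 - a) with hp
    have hH := hsub x0 (fun y => k * ‖y - a‖ ^ 2) (pen_contDiff a k)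
      (Filter.Eventually.of_forall hmax)
    rw [hasGrad, ← hp] at hH
    have hHv : ∀ v, ⟪-p, v⟫ - L x0 v ≤ Hbar := fun v =>
      le_trans (le_ciSup (Ham_bdd hsl x0 (-p)) v) hH
    have hpR : ‖p‖ ≤ R := by
      obtain ⟨v, hv1, hv2⟩ := unit_vec (-p)
      have h1 := hHv v
      have h2 := hM x0 v hv1
      rw [hv2, norm_neg] at h1
      linarith
    have hHlow : -M ≤ Hbar := by
      have h1 := hHv 0
      have h2 := hM x0 0 (by simp)
      simp at h1
      linarith
    suffices h : HN ≤ Hbar + (d * c + |K| * R) * s by linarith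
    rw [← hφ y0]
    apply ciSup_le
    intro v
    have hpl := pairL_le (ξ := negDeltaN φ y0) (p := -p) (e := s / 2) (by positivity)
      (fun i => by
        have h1 := hp1 i
        rw [hkn] at h1
        simp only [dplus] at h1
        simp only [negDeltaN, dplus, hp, PiLp.neg_apply, PiLp.smul_apply, smul_eq_mul]
        linarith)
      (fun i => by
        have h1 := hp2 i
        rw [hkn] at h1
        simp only [dminus] at h1
        simp only [negDeltaN, dminus, hp, PiLp.neg_apply, PiLp.smul_apply, smul_eq_mul]
        linarith) v
    rw [← ha]
    rcases le_or_gt ‖v‖ c with hv | hv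
    · have h1 := hHv v
      have h2 := abs_le.1 (hLdiff x0 a v hv hpR)
      have h3 := hpen v hv
      linarith
    · have h1 := hlarge a v hv
      have h2 := real_inner_le_norm (-p) v
      rw [norm_neg] at h2
      have h3 := mul_le_mul_of_nonneg_right hpR (norm_nonneg v)
      have h4 := hpen' v
      linarith
  · -- Hbar ≤ HN + C s
    obtain ⟨x0, y0, hmax, hp1, hp2⟩ := doubling (w := fun x => -u x) huc.neg
      (fun x i => by rw [hup]) φ hk0
    set a := latE d (N + 1) y0 with ha
    set p : Evec d := (2 * k) • (x0 - a) with hp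
    have hH := hsup x0 (fun y => (-k) * ‖y - a‖ ^ 2) (pen_contDiff a (-k))
      (Filter.Eventually.of_forall fun x => by
        have := hmax x
        simp only at this ⊢
        linarith)
    have hg : -((2 * -k) • (x0 - a)) = p := by rw [hp]; module
    rw [hasGrad, hg] at hH
    have hHv : ∀ v, ⟪p, v⟫ - s / 2 * d * ‖v‖ - L a v ≤ HN := by
      intro v
      rw [← hφ y0]
      refine le_trans ?_ (le_ciSup (HN_bdd hsl _ _) v)
      have := le_pairL (ξ := negDeltaN φ y0) (p := p) (e := s / 2) (by positivity)
        (fun i => by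
          have h1 := hp1 i
          rw [hkn] at h1
          simp only [negDeltaN, hp, PiLp.smul_apply, smul_eq_mul]
          linarith)
        (fun i => by
          have h1 := hp2 i
          rw [hkn] at h1
          simp only [negDeltaN, hp, PiLp.smul_apply, smul_eq_mul]
          linarith) v
      linarith
    have hpR : ‖p‖ ≤ R := by
      obtain ⟨v, hv1, hv2⟩ := unit_vec p
      have h1 := hHv v
      have h2 := hM a v hv1
      have h3 := hpen' v
      have h4 := mul_le_mul_of_nonneg_left hv1 hd0
      rw [hv2] at h1
      linarith
    suffices h : Ham d L x0 p ≤ HN + (d * c + |K| * R) * s by linarith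
    apply ciSup_le
    intro v
    rcases le_or_gt ‖v‖ c with hv | hv
    · have h1 := hHv v
      have h2 := abs_le.1 (hLdiff x0 a v hv hpR)
      have h3 := hpen v hv
      linarith
    · have h1 := hlarge x0 v hv
      have h2 := real_inner_le_norm p v
      have h3 := mul_le_mul_of_nonneg_right hpR (norm_nonneg v)
      have h4 : 0 ≤ d * ‖v‖ := by positivity
      linarith
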